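/- Let p be an odd prime, let f : ℤ_p → ℤ_p be everywhere analytic with integral coefficients, let λ ∈ ℚ_p with ‖λ‖_p > 1, and let s ∈ ℤ_p with s ≠ 1. Then all Volkenborn integrals B_m^f(0) := ∫_{ℤ_p} f(a)^m da exist, the Volkenborn integral ∫_{ℤ_p} ⟨λ+f(a)⟩^{1−s} da exists, the series Σ_{m=0}^∞ C(1−s,m)·B_m^f(0)·λ^{−m} converges, and ζ_p^f(s,λ) = (s−1)^{−1}·⟨λ⟩^{1−s}·Σ_{m=0}^∞ C(1−s,m)·B_m^f(0)·λ^{−m}. -/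

import Mathlib

open Filter Topology

namespace PZeta

variable (p : ℕ) [Fact p.Prime]

/-- The `N`-th partial sum defining the fermionic integral
`∫_{ℤ_p} g dμ₋₁ = lim_N Σ_{a=0}^{p^N-1} (-1)^a g(a)`. -/
noncomputable def fermSum (g : ℤ_[p] → ℚ_[p]) (N : ℕ) : ℚ_[p] :=
  ∑ a ∈ Finset.range (p ^ N), (-1 : ℚ_[p]) ^ a * g (a : ℤ_[p])

/-- The `N`-th partial sum defining the Volkenborn integral
`∫_{ℤ_p} g da = lim_N p^{-N} Σ_{a=0}^{p^N-1} g(a)`. -/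
noncomputable def volkSum (g : ℤ_[p] → ℚ_[p]) (N : ℕ) : ℚ_[p] :=
  ((p : ℚ_[p]) ^ N)⁻¹ * ∑ a ∈ Finset.range (p ^ N), g (a : ℤ_[p])

/-- The unit part `x·p^{-v_p(x)}` of a nonzero `p`-adic number. -/
noncomputable def unitPart (x : ℚ_[p]) : ℚ_[p] := x * (p : ℚ_[p]) ^ (-x.valuation)

/-- The Teichmüller representative of a `p`-adic unit, `lim_n x^{p^n}`. -/
noncomputable def teich (x : ℚ_[p]) : ℚ_[p] :=
  limUnder atTop fun n : ℕ => x ^ p ^ n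

/-- The projection `⟨x⟩ ∈ 1 + pℤ_p`, via `x = p^{v_p(x)}·ζ·⟨x⟩`. -/
noncomputable def angle (x : ℚ_[p]) : ℚ_[p] := unitPart p x / teich p (unitPart p x)

/-- `ω_v(x) := x / ⟨x⟩ = p^{v_p(x)}·ζ`. -/
noncomputable def omegaV (x : ℚ_[p]) : ℚ_[p] := x / angle p x

/-- The generalized binomial coefficient `C(t,n) = t(t-1)⋯(t-n+1)/n!`. -/
noncomputable def gbinom (t : ℚ_[p]) (n : ℕ) : ℚ_[p] :=
  (∏ i ∈ Finset.range n, (t - (i : ℚ_[p]))) / (n.factorial : ℚ_[p])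

/-- The power `y^t` defined by the binomial series `Σ_n C(t,n)(y-1)^n`
(used for `y ∈ 1 + pℤ_p` and `t ∈ ℤ_p`). -/
noncomputable def bpow (y t : ℚ_[p]) : ℚ_[p] := ∑' n : ℕ, gbinom p t n * (y - 1) ^ n

/-- The Iwasawa `p`-adic logarithm: `log_p x = Σ_{n≥1} (-1)^{n+1}(⟨x⟩-1)^n/n`
(one has `log_p p = 0` and `log_p ζ = 0` for roots of unity of order prime to `p`). -/
noncomputable def padicLog (x : ℚ_[p]) : ℚ_[p] :=
  ∑' n : ℕ, (-1 : ℚ_[p]) ^ n * (angle p x - 1) ^ (n + 1) / ((n : ℚ_[p]) + 1)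

/-- The power `y^t` defined by the exponential series `Σ_n (t·log_p y)^n/n!`
(used for `y ∈ 1 + pℤ_p` and `‖t‖ < p^{(p-2)/(p-1)}`). -/
noncomputable def epow (y t : ℚ_[p]) : ℚ_[p] :=
  ∑' n : ℕ, (t * padicLog p y) ^ n / (n.factorial : ℚ_[p])

/-- `f : ℤ_p → ℤ_p` is everywhere analytic with integral coefficients:
`f(x) = Σ_k c_k x^k` with `‖c_k‖ ≤ 1`, `c_k → 0`. -/
def EverywhereAnalytic (f : ℤ_[p] → ℤ_[p]) : Prop :=
  ∃ c : ℕ → ℚ_[p], (∀ k, ‖c k‖ ≤ 1) ∧ Tendsto c atTop (𝓝 0) ∧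
    ∀ x : ℤ_[p], (f x : ℚ_[p]) = ∑' k : ℕ, c k * (x : ℚ_[p]) ^ k

/-- The `p`-adic Hurwitz-type Euler zeta function w.r.t. `f`:
`ζ_{p,E}^f(s,λ) = ∫_{ℤ_p} ⟨λ+f(a)⟩^{1-s} dμ₋₁(a)`. -/
noncomputable def zetaE (f : ℤ_[p] → ℤ_[p]) (s : ℤ_[p]) (lam : ℚ_[p]) : ℚ_[p] :=
  limUnder atTop
    (fermSum p fun a => bpow p (angle p (lam + (f a : ℚ_[p]))) (1 - (s : ℚ_[p])))

/-- The `p`-adic Hurwitz zeta function w.r.t. `f`: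
`ζ_p^f(s,λ) = (s-1)⁻¹ ∫_{ℤ_p} ⟨λ+f(a)⟩^{1-s} da`. -/
noncomputable def zetaH (f : ℤ_[p] → ℤ_[p]) (s : ℤ_[p]) (lam : ℚ_[p]) : ℚ_[p] :=
  ((s : ℚ_[p]) - 1)⁻¹ *
    limUnder atTop
      (volkSum p fun a => bpow p (angle p (lam + (f a : ℚ_[p]))) (1 - (s : ℚ_[p])))

end PZeta

open PZeta

namespace PZeta

open Polynomial

variable {p : ℕ} [Fact p.Prime]

section Volkenborn

theorem sum_range_mul_eq {M : Type*} [AddCommMonoid M] (g : ℕ → M) (m n : ℕ) :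
    ∑ a ∈ Finset.range (m * n), g a =
      ∑ j ∈ Finset.range n, ∑ a ∈ Finset.range m, g (m * j + a) := by
  induction n with
  | zero => simp
  | succ n ih => rw [Nat.mul_succ, Finset.sum_range_add, ih, Finset.sum_range_succ]

/-- The sum of a polynomial with `p`-adic integer coefficients over `0, …, p ^ N - 1`. -/
noncomputable def polySum (P : ℤ_[p][X]) (N : ℕ) : ℤ_[p] :=
  ∑ a ∈ Finset.range (p ^ N), P.eval (a : ℤ_[p])

theorem polySum_succ (hp : Odd p) (P : ℤ_[p][X]) (N : ℕ) :
    ∃ q r : ℤ_[p], polySum P (N + 1) - p * polySum P N =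
      p ^ N * (p * polySum (derivative P) N) * q + p ^ (2 * N) * r := by
  choose k hk using fun x y : ℤ_[p] => (⟨_, (P.binomExpansion x y).2⟩ :
    ∃ k, P.eval (x + y) = P.eval x + (derivative P).eval x * y + k * y ^ 2)
  obtain ⟨q, hq⟩ : ∃ q : ℕ, ∑ j ∈ Finset.range p, j = p * q := by
    obtain ⟨q, hq⟩ := hp
    refine ⟨q, ?_⟩
    have h := Finset.sum_range_id_mul_two p
    have h2 : p - 1 = 2 * q := by lia
    rw [h2] at h
    linarith
  refine ⟨q, ∑ j ∈ Finset.range p, ∑ a ∈ Finset.range (p ^ N),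
    k a (p ^ N * j) * j ^ 2, ?_⟩
  have hq' : ∑ j ∈ Finset.range p, (j : ℤ_[p]) = p * q := by
    rw [← Nat.cast_sum, hq, Nat.cast_mul]
  have hterm : ∀ j a : ℕ, P.eval ((p ^ N * j + a : ℕ) : ℤ_[p]) = P.eval (a : ℤ_[p]) +
      p ^ N * ((j : ℤ_[p]) * (derivative P).eval (a : ℤ_[p])) +
      p ^ (2 * N) * (k a (p ^ N * j) * j ^ 2) := by
    intro j a
    have : ((p ^ N * j + a : ℕ) : ℤ_[p]) = a + p ^ N * j := by push_cast; ring
    rw [this, hk]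
    ring
  have hS : polySum P (N + 1) = p * polySum P N +
      p ^ N * ((∑ j ∈ Finset.range p, (j : ℤ_[p])) * polySum (derivative P) N) +
      p ^ (2 * N) * ∑ j ∈ Finset.range p, ∑ a ∈ Finset.range (p ^ N),
        k a (p ^ N * j) * j ^ 2 := by
    simp only [polySum]
    rw [pow_succ, sum_range_mul_eq]
    simp_rw [hterm, Finset.sum_add_distrib, ← Finset.mul_sum]
    rw [Finset.sum_mul]
    simp
  rw [hS, hq']
  ring

theorem pow_dvd_mul_polySum (hp : Odd p) (N : ℕ) (P : ℤ_[p][X]) :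
    (p : ℤ_[p]) ^ N ∣ p * polySum P N := by
  induction N generalizing P with
  | zero => simp
  | succ N ih =>
    obtain ⟨q, r, h⟩ := polySum_succ hp P N
    obtain ⟨c, hc⟩ := ih P
    obtain ⟨d, hd⟩ := ih (derivative P)
    rw [hc, hd, sub_eq_iff_eq_add] at h
    refine ⟨p ^ N * d * q + p ^ N * r + c, ?_⟩
    rw [h]
    ring

theorem pow_dvd_polySum_succ_sub (hp : Odd p) (N : ℕ) (P : ℤ_[p][X]) :
    (p : ℤ_[p]) ^ (2 * N) ∣ polySum P (N + 1) - p * polySum P N := by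
  obtain ⟨q, r, h⟩ := polySum_succ hp P N
  obtain ⟨d, hd⟩ := pow_dvd_mul_polySum hp N (derivative P)
  refine ⟨d * q + r, ?_⟩
  rw [h, hd]
  ring

theorem volkSum_polynomial (P : ℤ_[p][X]) (N : ℕ) :
    volkSum p (fun x => ((P.eval x : ℤ_[p]) : ℚ_[p])) N = ((p : ℚ_[p]) ^ N)⁻¹ * (polySum P N : ℤ_[p]) := by
  simp [volkSum, polySum, PadicInt.coe_sum]

theorem natCast_prime_ne_zero : (p : ℚ_[p]) ≠ 0 :=
  Nat.cast_ne_zero.mpr (Fact.out : p.Prime).ne_zero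

theorem norm_volkSum_polynomial_le (hp : Odd p) (P : ℤ_[p][X]) (N : ℕ) :
    ‖volkSum p (fun x => ((P.eval x : ℤ_[p]) : ℚ_[p])) N‖ ≤ p := by
  have hp0 := natCast_prime_ne_zero (p := p)
  obtain ⟨c, hc⟩ := pow_dvd_mul_polySum hp N P
  have hc' : (p : ℚ_[p]) * (polySum P N : ℤ_[p]) = p ^ N * c := by exact_mod_cast congrArg _ hc
  have : volkSum p (fun x => ((P.eval x : ℤ_[p]) : ℚ_[p])) N = (p : ℚ_[p])⁻¹ * c := by
    rw [volkSum_polynomial]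
    field_simp
    linear_combination hc'
  rw [this, norm_mul, norm_inv, Padic.norm_p, inv_inv]
  exact mul_le_of_le_one_right (by positivity) c.norm_le_one

theorem norm_volkSum_polynomial_succ_sub_le (hp : Odd p) (P : ℤ_[p][X]) (N : ℕ) :
    ‖volkSum p (fun x => ((P.eval x : ℤ_[p]) : ℚ_[p])) (N + 1) -
      volkSum p (fun x => ((P.eval x : ℤ_[p]) : ℚ_[p])) N‖ ≤ p * (p : ℝ)⁻¹ ^ N := by
  have hp0 := natCast_prime_ne_zero (p := p)
  obtain ⟨c, hc⟩ := pow_dvd_polySum_succ_sub hp N P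
  have hc' : (polySum P (N + 1) : ℚ_[p]) - p * (polySum P N : ℤ_[p]) = p ^ (2 * N) * c := by
    exact_mod_cast congrArg _ hc
  have : volkSum p (fun x => ((P.eval x : ℤ_[p]) : ℚ_[p])) (N + 1) -
      volkSum p (fun x => ((P.eval x : ℤ_[p]) : ℚ_[p])) N = (p : ℚ_[p])⁻¹ * p ^ N * c := by
    rw [volkSum_polynomial, volkSum_polynomial, sub_eq_iff_eq_add.mp hc', pow_succ]
    field_simp
    ring
  rw [this, norm_mul, norm_mul, norm_inv, norm_pow, Padic.norm_p, inv_inv]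
  exact mul_le_of_le_one_right (by positivity) c.norm_le_one

/-- `g` is a pointwise limit of polynomials with `p`-adic integer coefficients. -/
def IsPolynomialLimit (g : ℤ_[p] → ℚ_[p]) : Prop :=
  ∃ P : ℕ → ℤ_[p][X], ∀ x, Tendsto (fun n => (((P n).eval x : ℤ_[p]) : ℚ_[p])) atTop (𝓝 (g x))

theorem IsPolynomialLimit.pow {g : ℤ_[p] → ℚ_[p]} (hg : IsPolynomialLimit g) (m : ℕ) :
    IsPolynomialLimit fun x => g x ^ m := by
  obtain ⟨P, hP⟩ := hg
  exact ⟨fun n => P n ^ m, fun x => by simpa using (hP x).pow m⟩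

theorem EverywhereAnalytic.isPolynomialLimit {f : ℤ_[p] → ℤ_[p]} (hf : EverywhereAnalytic p f) :
    IsPolynomialLimit fun x => (f x : ℚ_[p]) := by
  obtain ⟨c, hc, hc0, hfc⟩ := hf
  obtain ⟨d, rfl⟩ : ∃ d : ℕ → ℤ_[p], (fun k => (d k : ℚ_[p])) = c := ⟨fun k => ⟨c k, hc k⟩, rfl⟩
  refine ⟨fun n => ∑ k ∈ Finset.range n, C (d k) * X ^ k, fun x => ?_⟩
  have hs : Summable fun k => (d k : ℚ_[p]) * (x : ℚ_[p]) ^ k := by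
    refine NonarchimedeanAddGroup.summable_of_tendsto_cofinite_zero ?_
    rw [Nat.cofinite_eq_atTop]
    refine squeeze_zero_norm (fun k => ?_) (tendsto_zero_iff_norm_tendsto_zero.mp hc0)
    rw [norm_mul, norm_pow]
    exact mul_le_of_le_one_right (norm_nonneg _) (pow_le_one₀ (norm_nonneg _) (PadicInt.norm_le_one x))
  simp only [hfc]
  refine hs.hasSum.tendsto_sum_nat.congr fun n => ?_
  simp [eval_finsetSum, PadicInt.coe_sum]

namespace IsPolynomialLimit

variable {g : ℤ_[p] → ℚ_[p]}

theorem tendsto_volkSum {P : ℕ → ℤ_[p][X]}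
    (hP : ∀ x, Tendsto (fun n => (((P n).eval x : ℤ_[p]) : ℚ_[p])) atTop (𝓝 (g x))) (N : ℕ) :
    Tendsto (fun n => volkSum p (fun x => (((P n).eval x : ℤ_[p]) : ℚ_[p])) N) atTop
      (𝓝 (volkSum p g N)) :=
  (tendsto_finsetSum _ fun _ _ => hP _).const_mul _

theorem norm_volkSum_le (hg : IsPolynomialLimit g) (hp : Odd p) (N : ℕ) :
    ‖volkSum p g N‖ ≤ p := by
  obtain ⟨P, hP⟩ := hg
  exact le_of_tendsto (tendsto_volkSum hP N).norm
    (Eventually.of_forall fun n => norm_volkSum_polynomial_le hp (P n) N)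

theorem norm_volkSum_succ_sub_le (hg : IsPolynomialLimit g) (hp : Odd p) (N : ℕ) :
    ‖volkSum p g (N + 1) - volkSum p g N‖ ≤ p * (p : ℝ)⁻¹ ^ N := by
  obtain ⟨P, hP⟩ := hg
  exact le_of_tendsto ((tendsto_volkSum hP (N + 1)).sub (tendsto_volkSum hP N)).norm
    (Eventually.of_forall fun n => norm_volkSum_polynomial_succ_sub_le hp (P n) N)

theorem exists_tendsto_volkSum (hg : IsPolynomialLimit g) (hp : Odd p) :
    ∃ B, Tendsto (volkSum p g) atTop (𝓝 B) := by
  refine cauchySeq_tendsto_of_complete (cauchySeq_of_le_geometric (p : ℝ)⁻¹ p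
    (inv_lt_one_of_one_lt₀ (mod_cast (Fact.out : p.Prime).one_lt)) fun N => ?_)
  rw [dist_comm, dist_eq_norm]
  exact hg.norm_volkSum_succ_sub_le hp N

end IsPolynomialLimit

end Volkenborn

section BinomialSeries

theorem gbinom_coe (t : ℤ_[p]) (n : ℕ) : gbinom p t n = (Ring.choose t n : ℤ_[p]) := by
  have h := Ring.descPochhammer_eq_factorial_smul_choose t n
  rw [← aeval_eq_smeval, aeval_def, ← eval_map, algebraMap_int_eq, descPochhammer_map,
    descPochhammer_eval_eq_prod_range, nsmul_eq_mul] at h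
  have h' : ∏ i ∈ Finset.range n, ((t : ℚ_[p]) - i) = n.factorial * (Ring.choose t n : ℤ_[p]) := by
    have := congrArg (PadicInt.Coe.ringHom (p := p)) h
    simp only [map_prod, map_mul, map_sub, map_natCast] at this
    exact this
  rw [gbinom, h', mul_div_cancel_left₀ _ (mod_cast n.factorial_ne_zero)]

theorem norm_gbinom_le_one (t : ℤ_[p]) (n : ℕ) : ‖gbinom p t n‖ ≤ 1 := by
  rw [gbinom_coe]
  exact PadicInt.norm_le_one _

theorem tendsto_sub_one_pow {y : ℚ_[p]} (hy : ‖y - 1‖ < 1) :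
    Tendsto (fun n : ℕ => (y - 1) ^ n) atTop (𝓝 0) :=
  tendsto_pow_atTop_nhds_zero_of_norm_lt_one hy

instance : IsBoundedSMul ℤ_[p] ℚ_[p] :=
  IsBoundedSMul.of_norm_smul_le fun r x => (norm_mul (r : ℚ_[p]) x).le

theorem bpow_eq_addChar {y : ℚ_[p]} (hy : ‖y - 1‖ < 1) (t : ℤ_[p]) :
    bpow p y t = PadicInt.addChar_of_value_at_one (y - 1) (tendsto_sub_one_pow hy) t := by
  rw [PadicInt.coe_addChar_of_value_at_one, PadicInt.mahlerSeries_apply (tendsto_sub_one_pow hy)]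
  simp only [bpow, gbinom_coe, mahler_apply]
  rfl

theorem norm_mul_sub_one_lt {y z : ℚ_[p]} (hy : ‖y - 1‖ < 1) (hz : ‖z - 1‖ < 1) :
    ‖y * z - 1‖ < 1 := by
  have h : y * z - 1 = (y - 1) * (z - 1) + ((y - 1) + (z - 1)) := by ring
  rw [h]
  refine (IsUltrametricDist.norm_add_le_max _ _).trans_lt (max_lt ?_ ?_)
  · rw [norm_mul]
    exact mul_lt_one_of_nonneg_of_lt_one_left (norm_nonneg _) hy hz.le
  · exact (IsUltrametricDist.norm_add_le_max _ _).trans_lt (max_lt hy hz)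

theorem bpow_mul {y z : ℚ_[p]} (hy : ‖y - 1‖ < 1) (hz : ‖z - 1‖ < 1) (t : ℤ_[p]) :
    bpow p (y * z) t = bpow p y t * bpow p z t := by
  rw [bpow_eq_addChar (norm_mul_sub_one_lt hy hz), bpow_eq_addChar hy, bpow_eq_addChar hz,
    ← AddChar.mul_apply]
  congr 1
  symm
  refine PadicInt.eq_addChar_of_value_at_one _ ?_ ?_
  · exact (PadicInt.continuous_addChar_of_value_at_one (tendsto_sub_one_pow hy)).mul
      (PadicInt.continuous_addChar_of_value_at_one (tendsto_sub_one_pow hz))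
  · rw [AddChar.mul_apply]
    simp

end BinomialSeries

section Angle

theorem coe_norm_le_inv_of_dvd {x : ℤ_[p]} {n : ℕ} (h : (p : ℤ_[p]) ^ n ∣ x) :
    ‖(x : ℚ_[p])‖ ≤ (p : ℝ)⁻¹ ^ n := by
  obtain ⟨c, rfl⟩ := h
  rw [PadicInt.coe_mul, PadicInt.coe_pow, PadicInt.coe_natCast, norm_mul, norm_pow, Padic.norm_p]
  exact mul_le_of_le_one_right (by positivity) c.norm_le_one

theorem dvd_pow_prime_pow_sub (x : ℤ_[p]) (n : ℕ) : (p : ℤ_[p]) ∣ x ^ p ^ n - x := by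
  rw [← Ideal.mem_span_singleton, ← PadicInt.maximalIdeal_eq_span_p, ← PadicInt.ker_toZMod,
    RingHom.mem_ker, map_sub, map_pow, ZMod.pow_card_pow, sub_self]

theorem tendsto_teich {x : ℚ_[p]} (hx : ‖x‖ ≤ 1) :
    Tendsto (fun n : ℕ => x ^ p ^ n) atTop (𝓝 (teich p x)) := by
  have hp1 : (p : ℝ)⁻¹ < 1 := inv_lt_one_of_one_lt₀ (mod_cast (Fact.out : p.Prime).one_lt)
  refine (cauchySeq_of_le_geometric (p : ℝ)⁻¹ 1 hp1 fun n => ?_).tendsto_limUnder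
  obtain ⟨x, rfl⟩ : ∃ z : ℤ_[p], (z : ℚ_[p]) = x := ⟨⟨x, hx⟩, rfl⟩
  have h : (p : ℤ_[p]) ∣ x ^ p - x := by simpa using dvd_pow_prime_pow_sub x 1
  have h2 := coe_norm_le_inv_of_dvd (dvd_sub_pow_of_dvd_sub h n)
  rw [dist_comm, dist_eq_norm, one_mul]
  refine le_trans ?_ (h2.trans (pow_le_pow_of_le_one (by positivity) hp1.le n.le_succ))
  rw [pow_succ' p n, pow_mul]
  simp

theorem norm_teich_sub_lt {x : ℚ_[p]} (hx : ‖x‖ ≤ 1) : ‖teich p x - x‖ < 1 := by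
  have hp1 : (p : ℝ)⁻¹ < 1 := inv_lt_one_of_one_lt₀ (mod_cast (Fact.out : p.Prime).one_lt)
  refine lt_of_le_of_lt (le_of_tendsto ((tendsto_teich hx).sub_const x).norm
    (Eventually.of_forall fun n => ?_)) hp1
  obtain ⟨x, rfl⟩ : ∃ z : ℤ_[p], (z : ℚ_[p]) = x := ⟨⟨x, hx⟩, rfl⟩
  have h := coe_norm_le_inv_of_dvd (n := 1) (by simpa using dvd_pow_prime_pow_sub x n)
  simpa using h

theorem norm_eq_one_of_norm_sub_one_lt {y : ℚ_[p]} (hy : ‖y - 1‖ < 1) : ‖y‖ = 1 := by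
  have h := IsUltrametricDist.norm_add_eq_max_of_norm_ne_norm (x := y - 1) (y := 1)
    (by rw [norm_one]; exact hy.ne)
  rw [sub_add_cancel, norm_one, max_eq_right hy.le] at h
  exact h

theorem tendsto_pow_prime_pow {y : ℚ_[p]} (hy : ‖y - 1‖ < 1) :
    Tendsto (fun n : ℕ => y ^ p ^ n) atTop (𝓝 1) := by
  have hp1 : (p : ℝ)⁻¹ < 1 := inv_lt_one_of_one_lt₀ (mod_cast (Fact.out : p.Prime).one_lt)
  rw [tendsto_iff_norm_sub_tendsto_zero]
  refine squeeze_zero (fun _ => norm_nonneg _) (fun n => ?_)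
    ((tendsto_pow_atTop_nhds_zero_of_lt_one (by positivity) hp1).comp (tendsto_add_atTop_nat 1))
  obtain ⟨y, rfl⟩ : ∃ z : ℤ_[p], (z : ℚ_[p]) = y := ⟨⟨y, (norm_eq_one_of_norm_sub_one_lt hy).le⟩, rfl⟩
  have h : (p : ℤ_[p]) ∣ y - 1 := by
    rw [← PadicInt.norm_lt_one_iff_dvd, PadicInt.norm_def]
    simpa using hy
  simpa using coe_norm_le_inv_of_dvd (dvd_sub_pow_of_dvd_sub h n)

theorem teich_mul {x y : ℚ_[p]} (hx : ‖x‖ ≤ 1) (hy : ‖y - 1‖ < 1) :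
    teich p (x * y) = teich p x := by
  refine tendsto_nhds_unique (tendsto_teich ?_) ?_
  · rwa [norm_mul, norm_eq_one_of_norm_sub_one_lt hy, mul_one]
  · simpa [mul_pow] using (tendsto_teich hx).mul (tendsto_pow_prime_pow hy)

theorem norm_unitPart {x : ℚ_[p]} (hx : x ≠ 0) : ‖unitPart p x‖ = 1 := by
  have hp0 : (p : ℝ) ≠ 0 := Nat.cast_ne_zero.mpr (Fact.out : p.Prime).ne_zero
  rw [unitPart, norm_mul, Padic.norm_eq_zpow_neg_valuation hx, norm_zpow, Padic.norm_p, inv_zpow',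
    neg_neg, ← zpow_add₀ hp0]
  simp

theorem norm_angle_sub_one_lt {x : ℚ_[p]} (hx : x ≠ 0) : ‖angle p x - 1‖ < 1 := by
  have hu := norm_unitPart hx
  have hlt := norm_teich_sub_lt hu.le
  have ht : ‖teich p (unitPart p x)‖ = 1 := by
    have h := IsUltrametricDist.norm_add_eq_max_of_norm_ne_norm
      (x := teich p (unitPart p x) - unitPart p x) (y := unitPart p x) (by rw [hu]; exact hlt.ne)
    rw [sub_add_cancel, hu, max_eq_right hlt.le] at h
    exact h
  have h0 : teich p (unitPart p x) ≠ 0 := norm_ne_zero_iff.mp (by rw [ht]; exact one_ne_zero)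
  rw [angle, div_sub_one h0, norm_div, ht, div_one, norm_sub_rev]
  exact hlt

theorem valuation_eq_zero_of_norm_eq_one {y : ℚ_[p]} (hy : ‖y‖ = 1) : y.valuation = 0 := by
  have hp1 : (1 : ℝ) < p := mod_cast (Fact.out : p.Prime).one_lt
  have hy0 : y ≠ 0 := norm_ne_zero_iff.mp (by rw [hy]; exact one_ne_zero)
  rw [Padic.norm_eq_zpow_neg_valuation hy0, zpow_eq_one_iff_right₀ (by positivity) hp1.ne'] at hy
  simpa using hy

theorem angle_mul {x y : ℚ_[p]} (hx : x ≠ 0) (hy : ‖y - 1‖ < 1) :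
    angle p (x * y) = angle p x * y := by
  have hy1 := norm_eq_one_of_norm_sub_one_lt hy
  have hy0 : y ≠ 0 := norm_ne_zero_iff.mp (by rw [hy1]; exact one_ne_zero)
  have hu : unitPart p (x * y) = unitPart p x * y := by
    rw [unitPart, unitPart, Padic.valuation_mul hx hy0, valuation_eq_zero_of_norm_eq_one hy1,
      add_zero]
    ring
  rw [angle, angle, hu, teich_mul (norm_unitPart hx).le hy]
  ring

end Angle

theorem bpow_angle_add {lam : ℚ_[p]} (hlam : 1 < ‖lam‖) (x t : ℤ_[p]) :
    bpow p (angle p (lam + x)) t =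
      bpow p (angle p lam) t * ∑' m : ℕ, gbinom p t m * (x : ℚ_[p]) ^ m / lam ^ m := by
  have h0 : lam ≠ 0 := norm_pos_iff.mp (one_pos.trans hlam)
  have hy : ‖(1 + x / lam) - 1‖ < 1 := by
    rw [add_sub_cancel_left, norm_div]
    exact (div_lt_one (one_pos.trans hlam)).mpr (x.norm_le_one.trans_lt hlam)
  have hmul : lam + x = lam * (1 + x / lam) := by field_simp
  rw [hmul, angle_mul h0 hy, bpow_mul (norm_angle_sub_one_lt h0) hy]
  congr 1
  refine tsum_congr fun m => ?_
  rw [add_sub_cancel_left, div_pow, mul_div_assoc]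

theorem norm_gbinom_mul_div_pow_le {lam : ℚ_[p]} (t : ℤ_[p]) {x : ℚ_[p]} {C : ℝ}
    (hx : ‖x‖ ≤ C) (m : ℕ) : ‖gbinom p t m * x / lam ^ m‖ ≤ C * ‖lam‖⁻¹ ^ m := by
  rw [div_eq_mul_inv, norm_mul, norm_mul, norm_inv, norm_pow, inv_pow]
  gcongr
  exact (mul_le_of_le_one_left (norm_nonneg _) (norm_gbinom_le_one t m)).trans hx

theorem summable_const_mul_inv_pow {lam : ℚ_[p]} (hlam : 1 < ‖lam‖) (C : ℝ) :
    Summable fun m : ℕ => C * ‖lam‖⁻¹ ^ m :=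
  (summable_geometric_of_lt_one (by positivity) (inv_lt_one_of_one_lt₀ hlam)).mul_left C

theorem volkSum_bpow_angle_add {lam : ℚ_[p]} (hlam : 1 < ‖lam‖) (f : ℤ_[p] → ℤ_[p]) (t : ℤ_[p])
    (N : ℕ) :
    volkSum p (fun a => bpow p (angle p (lam + f a)) t) N = bpow p (angle p lam) t *
      ∑' m : ℕ, gbinom p t m * volkSum p (fun a => (f a : ℚ_[p]) ^ m) N / lam ^ m := by
  have hs (x : ℤ_[p]) : Summable fun m : ℕ => gbinom p t m * (x : ℚ_[p]) ^ m / lam ^ m := by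
    refine Summable.of_norm_bounded (summable_const_mul_inv_pow hlam 1) fun m =>
      norm_gbinom_mul_div_pow_le t ?_ m
    rw [norm_pow]
    exact pow_le_one₀ (norm_nonneg _) (PadicInt.norm_le_one x)
  simp only [volkSum, bpow_angle_add hlam]
  rw [← Finset.mul_sum, ← Summable.tsum_finsetSum fun (a : ℕ) _ => hs (f a), mul_left_comm,
    ← tsum_mul_left]
  congr 1
  refine tsum_congr fun m => ?_
  rw [← Finset.sum_div, ← Finset.mul_sum]
  ring

end PZeta

/-- power series expansion of the `p`-adic Hurwitz zeta function w.r.t. an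
everywhere analytic `f`: all `B_m^f(0) = ∫_{ℤ_p} f(a)^m da` exist, the Volkenborn integral
`I = ∫_{ℤ_p} ⟨λ+f(a)⟩^{1-s} da` exists, `Σ_m C(1-s,m) B_m^f(0) λ^{-m}` converges, and
`ζ_p^f(s,λ) = (s-1)⁻¹ I = (s-1)⁻¹ ⟨λ⟩^{1-s} Σ_m C(1-s,m) B_m^f(0) λ^{-m}`. -/
theorem zetaH_power_series (p : ℕ) [Fact p.Prime] (hp : Odd p)
    (f : ℤ_[p] → ℤ_[p]) (hf : EverywhereAnalytic p f)
    (lam : ℚ_[p]) (hlam : 1 < ‖lam‖) (s : ℤ_[p]) (hs : s ≠ 1) :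
    ∃ (B : ℕ → ℚ_[p]) (I : ℚ_[p]),
      (∀ m : ℕ, Filter.Tendsto (volkSum p fun a => ((f a : ℚ_[p])) ^ m)
        Filter.atTop (nhds (B m))) ∧
      Filter.Tendsto
        (volkSum p fun a => bpow p (angle p (lam + (f a : ℚ_[p]))) (1 - (s : ℚ_[p])))
        Filter.atTop (nhds I) ∧
      Summable (fun m : ℕ => gbinom p (1 - (s : ℚ_[p])) m * B m / lam ^ m) ∧
      ((s : ℚ_[p]) - 1)⁻¹ * I =
        ((s : ℚ_[p]) - 1)⁻¹ * bpow p (angle p lam) (1 - (s : ℚ_[p])) *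
          ∑' m : ℕ, gbinom p (1 - (s : ℚ_[p])) m * B m / lam ^ m := by
  have hP := hf.isPolynomialLimit
  choose B hB using fun m : ℕ => (hP.pow m).exists_tendsto_volkSum hp
  have ht : (1 : ℚ_[p]) - s = ((1 - s : ℤ_[p]) : ℚ_[p]) := by simp
  rw [ht]
  have hBp (m : ℕ) : ‖B m‖ ≤ p :=
    le_of_tendsto (hB m).norm
      (Eventually.of_forall fun N => (hP.pow m).norm_volkSum_le hp N)
  refine ⟨B, bpow p (angle p lam) (1 - s : ℤ_[p]) *
    ∑' m : ℕ, gbinom p (1 - s : ℤ_[p]) m * B m / lam ^ m, hB, ?_, ?_, ?_⟩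
  · refine Tendsto.congr (fun N => (volkSum_bpow_angle_add hlam f (1 - s) N).symm) ?_
    refine Tendsto.const_mul _ (tendsto_tsum_of_dominated_convergence
      (summable_const_mul_inv_pow hlam p) (fun m => ((hB m).const_mul _).div_const _)
      (Eventually.of_forall fun N m => norm_gbinom_mul_div_pow_le _ ?_ m))
    exact (hP.pow m).norm_volkSum_le hp N
  · exact Summable.of_norm_bounded (summable_const_mul_inv_pow hlam p) fun m =>
      norm_gbinom_mul_div_pow_le _ (hBp m) m
  · rw [mul_assoc]
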